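/- arXiv:2404.02364 — 2 statements merged into one kernel-verified Lean document; each statement's English description precedes it below -/
import Mathlib

section
/- There exists a universal constant C > 0 such that the following holds. Let ε ∈ (0, 1/2), T > 0, let ŵ be a unit vector in ℝᵈ, let τ̂ ∈ [−T, T], and set γ = 10·(εT + ε^{2/3}). Let X be a nonempty finite multiset (list) of points in ℝᵈ such that: (i) the fraction of x ∈ X with |ŵ·x + τ̂| ≤ γ is at most 5γ, and (ii) for every unit vector v ∈ ℝᵈ, the empirical second moment (1/|X|)·∑_{x∈X} (v·x)² is at most 2. Then for every unit vector w ∈ ℝᵈ and every τ ∈ ℝ with ∠(w, ŵ) ≤ ε and |τ − τ̂| ≤ ε, the fraction of x ∈ X with sign(w·x + τ) ≠ sign(ŵ·x + τ̂) is at most C·(εT + ε^{2/3}). -/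
open scoped RealInnerProductSpace
open InnerProductGeometry

/-- The fraction of elements of the list (multiset) `X` satisfying the property `P`. -/
noncomputable def frac {α : Type*} (X : List α) (P : α → Prop) : ℝ :=
  ((X.countP fun x => @decide (P x) (Classical.propDecidable _)) : ℝ) / (X.length : ℝ)

/-- `sign(z) = 1` if `z ≥ 0`, and `−1` if `z < 0`. -/
noncomputable def sgn (z : ℝ) : ℝ := if 0 ≤ z then 1 else -1

theorem frac_le_frac_add_sum_div {α : Type*} (X : List α) {P Q : α → Prop} {f : α → ℝ}
    (hf : ∀ x, 0 ≤ f x) (h : ∀ x, P x → Q x ∨ 1 ≤ f x) :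
    frac X P ≤ frac X Q + (X.map f).sum / (X.length : ℝ) := by
  classical
  have key : ((X.countP fun x => @decide (P x) (Classical.propDecidable _)) : ℝ) ≤
      ((X.countP fun x => @decide (Q x) (Classical.propDecidable _)) : ℝ) + (X.map f).sum := by
    induction X with
    | nil => simp
    | cons a l ih =>
      have ha := hf a
      have hPQ := h a
      simp only [List.countP_cons, List.map_cons, List.sum_cons, decide_eq_true_eq]
      by_cases hP : P a
      · by_cases hQ : Q a
        · simp only [hP, hQ, if_true]
          push_cast
          linarith
        · have h1 : 1 ≤ f a := (hPQ hP).resolve_left hQ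
          simp only [hP, hQ, if_true, if_false]
          push_cast
          linarith
      · by_cases hQ : Q a
        · simp only [hP, hQ, if_true, if_false]
          push_cast
          linarith
        · simp only [hP, hQ, if_false]
          push_cast
          linarith
  unfold frac
  rw [← add_div]
  gcongr

theorem abs_le_abs_sub_of_sgn_ne {a b : ℝ} (h : sgn b ≠ sgn a) : |a| ≤ |b - a| := by
  unfold sgn at h
  split_ifs at h with hb ha ha
  · exact absurd rfl h
  · rw [abs_of_neg (not_le.mp ha), abs_of_nonneg (by linarith)]
    linarith
  · rw [abs_of_nonneg ha, abs_of_neg (by linarith)]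
    linarith
  · exact absurd rfl h

theorem norm_sub_le_angle {E : Type*} [NormedAddCommGroup E] [InnerProductSpace ℝ E]
    {v w : E} (hv : ‖v‖ = 1) (hw : ‖w‖ = 1) : ‖v - w‖ ≤ angle v w := by
  refine abs_le_of_sq_le_sq' ?_ (angle_nonneg v w) |>.2
  have h1 := norm_sub_sq_real v w
  have h2 := cos_angle v w
  have h3 := Real.one_sub_sq_div_two_le_cos (x := angle v w)
  rw [hv, hw] at *
  norm_num at h2
  linarith

/-- A bound on the empirical second moment along unit vectors extends to all vectors by scaling. -/
theorem sum_inner_sq_div_le {E : Type*} [NormedAddCommGroup E] [InnerProductSpace ℝ E]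
    {X : List E} {M : ℝ}
    (h : ∀ v : E, ‖v‖ = 1 → (X.map fun x => ⟪v, x⟫ ^ 2).sum / (X.length : ℝ) ≤ M) (u : E) :
    (X.map fun x => ⟪u, x⟫ ^ 2).sum / (X.length : ℝ) ≤ ‖u‖ ^ 2 * M := by
  rcases eq_or_ne u 0 with rfl | hu
  · simp
  · have hn : ‖u‖ ≠ 0 := norm_ne_zero_iff.mpr hu
    have h1 := h (‖u‖⁻¹ • u) (by simp [norm_smul, hn])
    have h2 : (X.map fun x => ⟪u, x⟫ ^ 2) =
        X.map fun x => ‖u‖ ^ 2 * ⟪‖u‖⁻¹ • u, x⟫ ^ 2 := by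
      refine List.map_congr_left fun x _ => ?_
      rw [real_inner_smul_left]
      field_simp
    rw [h2, List.sum_map_mul_left, mul_div_assoc]
    gcongr

/-- Tester for local general halfspace disagreement: soundness.
There is a universal constant `C > 0` such that if the empirical margin test and the empirical
second moment test pass, then any general halfspace whose parameters are close to `(wh, τh)`
disagrees with the halfspace `(wh, τh)` on at most a `C(εT + ε^{2/3})` fraction of `X`. -/
theorem local_general_halfspace_disagreement :
    ∃ C : ℝ, 0 < C ∧
      ∀ (d : ℕ) (ε T : ℝ), 0 < ε → ε < 1/2 → 0 < T →
        ∀ wh : EuclideanSpace ℝ (Fin d), ‖wh‖ = 1 →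
          ∀ τh : ℝ, -T ≤ τh → τh ≤ T →
            ∀ γ : ℝ, γ = 10 * (ε * T + ε ^ ((2 : ℝ)/3)) →
              ∀ X : List (EuclideanSpace ℝ (Fin d)), X ≠ [] →
                frac X (fun x => |⟪wh, x⟫ + τh| ≤ γ) ≤ 5 * γ →
                (∀ v : EuclideanSpace ℝ (Fin d), ‖v‖ = 1 →
                  (X.map fun x => ⟪v, x⟫ ^ 2).sum / (X.length : ℝ) ≤ 2) →
                ∀ (w : EuclideanSpace ℝ (Fin d)) (τ : ℝ), ‖w‖ = 1 →
                  angle w wh ≤ ε → |τ - τh| ≤ ε →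
                  frac X (fun x => sgn (⟪w, x⟫ + τ) ≠ sgn (⟪wh, x⟫ + τh)) ≤
                    C * (ε * T + ε ^ ((2 : ℝ)/3)) := by
  refine ⟨51, by norm_num, ?_⟩
  intro d ε T hε hε2 hT wh hwh τh _ _ γ hγ X _ hmargin hmoment w τ hw hangle hτ
  set δ : ℝ := ε ^ ((2 : ℝ) / 3) with hδ
  have hδ0 : 0 < δ := Real.rpow_pos_of_pos hε _
  have hδ3 : δ ^ 3 = ε ^ 2 := by
    rw [hδ, ← Real.rpow_natCast, ← Real.rpow_mul hε.le, ← Real.rpow_natCast]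
    norm_num
  have hεδ : ε ≤ δ := Real.self_le_rpow_of_le_one hε.le (by linarith) (by norm_num)
  have hεT : 0 < ε * T := mul_pos hε hT
  have hu : ‖w - wh‖ ≤ ε := (norm_sub_le_angle hw hwh).trans hangle
  have hfrac := frac_le_frac_add_sum_div X
    (P := fun x => sgn (⟪w, x⟫ + τ) ≠ sgn (⟪wh, x⟫ + τh))
    (Q := fun x => |⟪wh, x⟫ + τh| ≤ γ)
    (f := fun x => (δ ^ 2)⁻¹ * ⟪w - wh, x⟫ ^ 2 / 2)
    (fun x => by positivity) (by
      intro x hx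
      by_contra! hcon
      obtain ⟨h1, h2⟩ := hcon
      have h3 := abs_le_abs_sub_of_sgn_ne hx
      have h4 : (⟪w, x⟫ + τ) - (⟪wh, x⟫ + τh) = ⟪w - wh, x⟫ + (τ - τh) := by
        rw [inner_sub_left]
        ring
      rw [h4] at h3
      have h5 := abs_add_le ⟪w - wh, x⟫ (τ - τh)
      have h6 : 2 * δ ≤ |⟪w - wh, x⟫| := by linarith
      have h7 : (2 * δ) ^ 2 ≤ ⟪w - wh, x⟫ ^ 2 := by
        rw [← sq_abs ⟪w - wh, x⟫]
        gcongr
      have h8 : (δ ^ 2)⁻¹ * (2 * δ) ^ 2 / 2 ≤ (δ ^ 2)⁻¹ * ⟪w - wh, x⟫ ^ 2 / 2 := by gcongr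
      have h9 : (δ ^ 2)⁻¹ * (2 * δ) ^ 2 / 2 = 2 := by
        field_simp
      linarith)
  have hsum : (X.map fun x => (δ ^ 2)⁻¹ * ⟪w - wh, x⟫ ^ 2 / 2).sum / (X.length : ℝ) ≤ δ := by
    have h1 : (X.map fun x => (δ ^ 2)⁻¹ * ⟪w - wh, x⟫ ^ 2 / 2) =
        X.map fun x => ((δ ^ 2)⁻¹ / 2) * ⟪w - wh, x⟫ ^ 2 :=
      List.map_congr_left fun x _ => by ring
    rw [h1, List.sum_map_mul_left, mul_div_assoc]
    calc _ ≤ ((δ ^ 2)⁻¹ / 2) * (‖w - wh‖ ^ 2 * 2) := by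
          gcongr
          exact sum_inner_sq_div_le hmoment _
      _ ≤ ((δ ^ 2)⁻¹ / 2) * (ε ^ 2 * 2) := by gcongr
      _ = δ := by
          rw [← hδ3]
          field_simp
  linarith
end

section
/- There exists a positive integer k₁ such that for every integer k ≥ k₁ the following holds. Let D₀ be a probability measure supported on a finite subset of ℝ such that |∫ xⁱ dD₀(x) − ∫ xⁱ dN(0,1)(x)| ≤ k^{−10k} for every integer i with 0 ≤ i ≤ 10k. Then there exists a probability measure D₁ supported on the same finite set as D₀ such that ∫ xⁱ dD₁(x) = ∫ xⁱ dN(0,1)(x) for every integer i with 0 ≤ i ≤ k, and D₁({x₀}) ≥ 0.9·D₀({x₀}) for every x₀ in the support of D₀. -/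
open MeasureTheory ProbabilityTheory

lemma integrable_pow_gaussianReal (n : ℕ) :
    Integrable (fun x : ℝ => x ^ n) (gaussianReal 0 1) := by
  have h : MemLp (id : ℝ → ℝ) n (gaussianReal 0 1) := memLp_id_gaussianReal' _ (by simp)
  rcases n.eq_zero_or_pos with rfl | hn
  · simp
  · refine (h.integrable_norm_pow hn.ne').mono' (by fun_prop) (ae_of_all _ fun x => ?_)
    simp

/-- A crude bound on the moments of the standard Gaussian. -/
lemma abs_integral_pow_gaussianReal_le (n : ℕ) :
    |∫ x, x ^ n ∂(gaussianReal 0 1)| ≤ 4 * (n.factorial : ℝ) := by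
  have hmgf (t : ℝ) (ht : t ^ 2 = 1) :
      ∫ x, Real.exp (t * x) ∂(gaussianReal 0 1) = Real.exp (1 / 2) := by
    have h := congrFun (mgf_id_gaussianReal (μ := 0) (v := 1)) t
    simpa [mgf, ht] using h
  have hexp : Real.exp (1 / 2) ≤ 2 := by
    have h : Real.exp (1 / 2) ^ 2 = Real.exp 1 := by
      rw [← Real.exp_nat_mul]; norm_num
    have := Real.exp_one_lt_d9
    nlinarith [Real.exp_pos (1 / 2)]
  have hpt (x : ℝ) :
      |x ^ n| ≤ n.factorial * (Real.exp (1 * x) + Real.exp (-1 * x)) := by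
    have h := Real.pow_div_factorial_le_exp |x| (abs_nonneg x) n
    rw [div_le_iff₀ (by positivity)] at h
    have h2 : Real.exp |x| ≤ Real.exp (1 * x) + Real.exp (-1 * x) := by
      rcases abs_cases x with ⟨h, _⟩ | ⟨h, _⟩ <;> rw [h] <;> simp [Real.exp_nonneg]
    rw [abs_pow]
    nlinarith [(Nat.cast_nonneg n.factorial : (0 : ℝ) ≤ _)]
  have hi (t : ℝ) := integrable_exp_mul_gaussianReal (μ := 0) (v := 1) t
  calc |∫ x, x ^ n ∂(gaussianReal 0 1)| ≤ ∫ x, |x ^ n| ∂(gaussianReal 0 1) :=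
        abs_integral_le_integral_abs
    _ ≤ ∫ x, n.factorial * (Real.exp (1 * x) + Real.exp (-1 * x)) ∂(gaussianReal 0 1) :=
        integral_mono (integrable_pow_gaussianReal n).abs
          (((hi 1).add (hi (-1))).const_mul _) hpt
    _ = n.factorial * (Real.exp (1 / 2) + Real.exp (1 / 2)) := by
        rw [integral_const_mul, integral_add (hi 1) (hi (-1)), hmgf 1 (by norm_num),
          hmgf (-1) (by norm_num)]
    _ ≤ 4 * n.factorial := by
        nlinarith [(Nat.cast_nonneg n.factorial : (0 : ℝ) ≤ _)]

/-- The standard Gaussian has density at least `1 / 6` on `[0, 1]`. -/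
lemma div_six_le_gaussianReal_Icc {a b : ℝ} (ha : 0 ≤ a) (hab : a ≤ b) (hb : b ≤ 1) :
    (b - a) / 6 ≤ (gaussianReal 0 1).real (Set.Icc a b) := by
  have hdens : ∀ x ∈ Set.Icc a b, (1 / 6 : ℝ) ≤ gaussianPDFReal 0 1 x := by
    intro x hx
    have hx0 : 0 ≤ x := ha.trans hx.1
    have hx1 : x ≤ 1 := hx.2.trans hb
    have h1 : √(2 * Real.pi) ≤ 2.51 := by
      apply Real.sqrt_le_iff.2
      have := Real.pi_lt_d4
      constructor
      · norm_num
      · norm_num at *; linarith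
    have h2 : (1 / 2 : ℝ) ≤ Real.exp (-x ^ 2 / 2) := by
      have := Real.add_one_le_exp (-x ^ 2 / 2)
      nlinarith
    have h3 : (2 / 5.02 : ℝ) ≤ (√(2 * Real.pi))⁻¹ := by
      rw [le_inv_comm₀ (by norm_num) (by positivity)]
      norm_num at *; linarith
    simp only [gaussianPDFReal, NNReal.coe_one, mul_one, sub_zero]
    norm_num at *
    nlinarith
  have h5 : (b - a) / 6 ≤ ∫ x in Set.Icc a b, gaussianPDFReal 0 1 x := by
    calc (b - a) / 6 = ∫ x in Set.Icc a b, (1 / 6 : ℝ) := by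
          simp [hab, div_eq_mul_inv]
      _ ≤ _ := setIntegral_mono_on (by simp) (integrable_gaussianPDFReal 0 1).integrableOn
          measurableSet_Icc hdens
  rw [Measure.real, gaussianReal_apply_eq_integral 0 one_ne_zero]
  rw [ENNReal.toReal_ofReal]
  · exact h5
  · exact integral_nonneg fun x => gaussianPDFReal_nonneg _ _ _

open Polynomial in
/-- Coefficients of a product of linear factors with roots in `[-1, 1]`. -/
lemma abs_coeff_prod_le {ι : Type*} [DecidableEq ι] (s : Finset ι) (a y : ι → ℝ) {B : ℝ}
    (ha : ∀ i ∈ s, |a i| ≤ B) (hy : ∀ i ∈ s, |y i| ≤ 1) (n : ℕ) :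
    |(∏ i ∈ s, (C (a i) * (X - C (y i)))).coeff n| ≤ (2 * B) ^ s.card := by
  induction s using Finset.induction_on generalizing n with
  | empty => simp only [Finset.prod_empty, coeff_one]; split_ifs <;> simp
  | insert i s hi ih =>
    rw [Finset.prod_insert hi, Finset.card_insert_of_notMem hi, mul_assoc, coeff_C_mul, sub_mul,
      coeff_sub, coeff_C_mul, abs_mul, pow_succ']
    have hB : 0 ≤ B := (abs_nonneg _).trans (ha i (by simp))
    have ih' := ih (fun j hj => ha j (by simp [hj])) (fun j hj => hy j (by simp [hj]))
    set q := ∏ i ∈ s, (C (a i) * (X - C (y i)))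
    have h1 : |(X * q).coeff n| ≤ (2 * B) ^ s.card := by
      cases n with
      | zero => simp; positivity
      | succ n => rw [coeff_X_mul]; exact ih' n
    have h2 : |y i * q.coeff n| ≤ (2 * B) ^ s.card := by
      rw [abs_mul]
      exact (mul_le_of_le_one_left (abs_nonneg _) (hy i (by simp))).trans (ih' n)
    calc |a i| * |(X * q).coeff n - y i * q.coeff n|
        ≤ B * ((2 * B) ^ s.card + (2 * B) ^ s.card) := by
          gcongr
          · exact ha i (by simp)
          · exact (abs_sub _ _).trans (add_le_add h1 h2)
      _ = 2 * B * (2 * B) ^ s.card := by ring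

open Polynomial in
/-- Coefficients of a polynomial of degree at most `k` are controlled by its values at `k + 1`
separated points of `[-1, 1]`. -/
lemma abs_coeff_le_of_abs_eval_le {k : ℕ} (c v : Fin (k + 1) → ℝ) {B η : ℝ} (hη : 0 ≤ η)
    (hv : ∀ j, |v j| ≤ 1) (hsep : ∀ i j, i ≠ j → 1 ≤ B * |v i - v j|)
    (hval : ∀ j, |∑ i, c i * v j ^ (i : ℕ)| ≤ η) (n : Fin (k + 1)) :
    |c n| ≤ (k + 1) * (η * (2 * B) ^ k) := by
  set p : ℝ[X] := ∑ i : Fin (k + 1), C (c i) * X ^ (i : ℕ) with hp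
  have hinj : Set.InjOn v (Finset.univ : Finset (Fin (k + 1))) := by
    intro i _ j _ hij
    by_contra h
    have := hsep i j h
    simp [hij] at this
    linarith
  have hdeg : p.degree < (Finset.univ : Finset (Fin (k + 1))).card := by
    rw [Finset.card_fin]
    refine (degree_sum_le _ _).trans_lt ((Finset.sup_lt_iff (WithBot.bot_lt_coe _)).2 fun i _ => ?_)
    exact (degree_C_mul_X_pow_le _ _).trans_lt (by exact_mod_cast i.2)
  have hcoeff : p.coeff n = c n := by
    simp [hp, coeff_X_pow, Fin.val_inj]
  have heval (j) : p.eval (v j) = ∑ i, c i * v j ^ (i : ℕ) := by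
    simp [hp, eval_finsetSum]
  rw [← hcoeff, Lagrange.eq_interpolate hinj hdeg, Lagrange.interpolate_apply, finsetSum_coeff]
  refine (Finset.abs_sum_le_sum_abs _ _).trans ?_
  calc _ ≤ ∑ j : Fin (k + 1), η * (2 * B) ^ k := by
        refine Finset.sum_le_sum fun j _ => ?_
        rw [coeff_C_mul, abs_mul, heval]
        refine mul_le_mul (hval j) ?_ (abs_nonneg _) hη
        have h := abs_coeff_prod_le (Finset.univ.erase j) (fun i => (v j - v i)⁻¹) v (B := B)
          (fun i hi => ?_) (fun i _ => hv i) n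
        · simpa [Lagrange.basis, Lagrange.basisDivisor] using h
        · have hij := hsep j i (Finset.ne_of_mem_erase hi).symm
          rw [abs_inv]
          have h0 : 0 < |v j - v i| := by
            rcases (abs_nonneg (v j - v i)).eq_or_lt with h | h
            · rw [← h] at hij; linarith
            · exact h
          exact (inv_le_iff_one_le_mul₀ h0).2 hij
    _ = _ := by simp

/-- A nonnegative function with large second moment and controlled third moment has large mean. -/
lemma sq_div_le_integral_of_nonneg {μ : Measure ℝ} {p : ℝ → ℝ} (hp : 0 ≤ᵐ[μ] p) (h1 : Integrable p μ)
    (h2 : Integrable (fun x => p x ^ 2) μ) (h3 : Integrable (fun x => p x ^ 3) μ) {b M : ℝ}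
    (hb : 0 ≤ b) (hM : 0 < M) (hb2 : b ≤ ∫ x, p x ^ 2 ∂μ) (hM3 : ∫ x, p x ^ 3 ∂μ ≤ M) :
    b ^ 2 / M ≤ ∫ x, p x ∂μ := by
  have h : ∫ x, 2 * (b / M) * p x ^ 2 - (b / M) ^ 2 * p x ^ 3 ∂μ ≤ ∫ x, p x ∂μ := by
    refine integral_mono_ae ((h2.const_mul _).sub (h3.const_mul _)) h1 ?_
    filter_upwards [hp] with x hx
    have := mul_nonneg hx (sq_nonneg (1 - b / M * p x))
    linarith
  rw [integral_sub (h2.const_mul _) (h3.const_mul _), integral_const_mul, integral_const_mul] at h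
  refine le_trans ?_ h
  have e1 : 2 * (b / M) * b ≤ 2 * (b / M) * ∫ x, p x ^ 2 ∂μ := by gcongr
  have e2 : (b / M) ^ 2 * ∫ x, p x ^ 3 ∂μ ≤ (b / M) ^ 2 * M := by gcongr
  have e3 : b ^ 2 / M = 2 * (b / M) * b - (b / M) ^ 2 * M := by field_simp; ring
  linarith

section Moments

variable {μ : Measure ℝ} (hμ : ∀ n : ℕ, Integrable (fun x : ℝ => x ^ n) μ) {k : ℕ}

lemma sq_sum_mul_pow (c : Fin k → ℝ) (x : ℝ) :
    (∑ i, c i * x ^ (i : ℕ)) ^ 2 = ∑ i, ∑ j, c i * c j * x ^ (i + j : ℕ) := by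
  rw [sq, Finset.sum_mul_sum]
  refine Finset.sum_congr rfl fun i _ => Finset.sum_congr rfl fun j _ => ?_
  ring

lemma cube_sum_mul_pow (c : Fin k → ℝ) (x : ℝ) :
    (∑ i, c i * x ^ (i : ℕ)) ^ 3 =
      ∑ i, ∑ j, ∑ l, c i * c j * c l * x ^ (i + j + l : ℕ) := by
  rw [pow_succ, sq_sum_mul_pow, Finset.sum_mul]
  refine Finset.sum_congr rfl fun i _ => ?_
  rw [Finset.sum_mul]
  refine Finset.sum_congr rfl fun j _ => ?_
  rw [Finset.mul_sum]
  refine Finset.sum_congr rfl fun l _ => ?_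
  ring

include hμ

lemma integrable_sum_mul_pow (c : Fin k → ℝ) :
    Integrable (fun x => ∑ i, c i * x ^ (i : ℕ)) μ :=
  integrable_finsetSum _ fun i _ => (hμ i).const_mul _

lemma integrable_sq_sum_mul_pow (c : Fin k → ℝ) :
    Integrable (fun x => (∑ i, c i * x ^ (i : ℕ)) ^ 2) μ := by
  simp_rw [sq_sum_mul_pow]
  exact integrable_finsetSum _ fun i _ => integrable_finsetSum _ fun j _ =>
    (hμ _).const_mul _

lemma integrable_cube_sum_mul_pow (c : Fin k → ℝ) :
    Integrable (fun x => (∑ i, c i * x ^ (i : ℕ)) ^ 3) μ := by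
  simp_rw [cube_sum_mul_pow]
  exact integrable_finsetSum _ fun i _ => integrable_finsetSum _ fun j _ =>
    integrable_finsetSum _ fun l _ => (hμ _).const_mul _

lemma integral_sum_mul_pow (c : Fin k → ℝ) :
    ∫ x, ∑ i, c i * x ^ (i : ℕ) ∂μ = ∑ i, c i * ∫ x, x ^ (i : ℕ) ∂μ := by
  rw [integral_finsetSum _ fun (i : Fin k) _ => (hμ i).const_mul (c i)]
  simp_rw [integral_const_mul]

lemma integral_sq_sum_mul_pow (c : Fin k → ℝ) :
    ∫ x, (∑ i, c i * x ^ (i : ℕ)) ^ 2 ∂μ =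
      ∑ i, ∑ j, c i * c j * ∫ x, x ^ (i + j : ℕ) ∂μ := by
  simp_rw [sq_sum_mul_pow]
  rw [integral_finsetSum _ fun i _ => integrable_finsetSum _ fun j _ => (hμ _).const_mul _]
  refine Finset.sum_congr rfl fun i _ => ?_
  rw [integral_finsetSum _ fun j _ => (hμ _).const_mul _]
  simp_rw [integral_const_mul]

lemma integral_cube_sum_mul_pow (c : Fin k → ℝ) :
    ∫ x, (∑ i, c i * x ^ (i : ℕ)) ^ 3 ∂μ =
      ∑ i, ∑ j, ∑ l, c i * c j * c l * ∫ x, x ^ (i + j + l : ℕ) ∂μ := by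
  simp_rw [cube_sum_mul_pow]
  rw [integral_finsetSum _ fun i _ => integrable_finsetSum _ fun j _ =>
    integrable_finsetSum _ fun l _ => (hμ _).const_mul _]
  refine Finset.sum_congr rfl fun i _ => ?_
  rw [integral_finsetSum _ fun j _ => integrable_finsetSum _ fun l _ => (hμ _).const_mul _]
  refine Finset.sum_congr rfl fun j _ => ?_
  rw [integral_finsetSum _ fun l _ => (hμ _).const_mul _]
  simp_rw [integral_const_mul]

lemma abs_integral_cube_sum_mul_pow_le (c : Fin (k + 1) → ℝ) (hc : ∑ i, |c i| = 1) {M : ℝ}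
    (hM : ∀ n ≤ 3 * k, |∫ x, x ^ n ∂μ| ≤ M) :
    |∫ x, (∑ i, c i * x ^ (i : ℕ)) ^ 3 ∂μ| ≤ M := by
  rw [integral_cube_sum_mul_pow hμ]
  calc _ ≤ ∑ i, ∑ j, ∑ l, |c i| * |c j| * |c l| * M := by
        refine (Finset.abs_sum_le_sum_abs _ _).trans (Finset.sum_le_sum fun i _ => ?_)
        refine (Finset.abs_sum_le_sum_abs _ _).trans (Finset.sum_le_sum fun j _ => ?_)
        refine (Finset.abs_sum_le_sum_abs _ _).trans (Finset.sum_le_sum fun l _ => ?_)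
        rw [abs_mul, abs_mul, abs_mul]
        exact mul_le_mul_of_nonneg_left (hM _ (by omega)) (by positivity)
    _ = M := by
        simp [← Finset.sum_mul, ← Finset.mul_sum, hc]

lemma abs_integral_sq_sub_integral_sq_le {ν : Measure ℝ}
    (hν : ∀ n : ℕ, Integrable (fun x : ℝ => x ^ n) ν)
    (c : Fin (k + 1) → ℝ) (hc : ∑ i, |c i| = 1) {ε : ℝ}
    (hε : ∀ n ≤ 2 * k, |(∫ x, x ^ n ∂μ) - ∫ x, x ^ n ∂ν| ≤ ε) :
    |(∫ x, (∑ i, c i * x ^ (i : ℕ)) ^ 2 ∂μ) - ∫ x, (∑ i, c i * x ^ (i : ℕ)) ^ 2 ∂ν| ≤ ε := by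
  rw [integral_sq_sum_mul_pow hμ, integral_sq_sum_mul_pow hν]
  simp_rw [← Finset.sum_sub_distrib, ← mul_sub]
  calc _ ≤ ∑ i, ∑ j, |c i| * |c j| * ε := by
        refine (Finset.abs_sum_le_sum_abs _ _).trans (Finset.sum_le_sum fun i _ => ?_)
        refine (Finset.abs_sum_le_sum_abs _ _).trans (Finset.sum_le_sum fun j _ => ?_)
        rw [abs_mul, abs_mul]
        exact mul_le_mul_of_nonneg_left (hε _ (by omega)) (by positivity)
    _ = ε := by
        simp [← Finset.sum_mul, ← Finset.mul_sum, hc]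

end Moments

/-- Lower bound for the Gaussian second moment of a polynomial with normalized coefficients. -/
lemma le_integral_sq_gaussianReal {k : ℕ} (c : Fin (k + 1) → ℝ) (hc : ∑ i, |c i| = 1) :
    (2 * (k + 1) ^ 2 * (2 * (2 * k + 1)) ^ k : ℝ)⁻¹ ^ 2 * (6 * (2 * k + 1) : ℝ)⁻¹ ≤
      ∫ x, (∑ i, c i * x ^ (i : ℕ)) ^ 2 ∂(gaussianReal 0 1) := by
  set η : ℝ := (2 * (k + 1) ^ 2 * (2 * (2 * k + 1)) ^ k : ℝ)⁻¹ with hη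
  have hη0 : 0 < η := by positivity
  by_contra! hlt
  have hpt : ∀ j : Fin (k + 1), ∃ v ∈ Set.Icc (2 * j / (2 * k + 1) : ℝ) ((2 * j + 1) / (2 * k + 1)),
      (∑ i, c i * v ^ (i : ℕ)) ^ 2 < η ^ 2 := by
    intro j
    by_contra! hall
    have hj : (j : ℝ) ≤ k := by exact_mod_cast Nat.lt_succ_iff.1 j.2
    have hmass := div_six_le_gaussianReal_Icc (a := (2 * j / (2 * k + 1) : ℝ))
      (b := (2 * j + 1) / (2 * k + 1)) (by positivity) (by gcongr; linarith)
      (by rw [div_le_one (by positivity)]; linarith)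
    have hmarkov := mul_meas_ge_le_integral_of_nonneg (μ := gaussianReal 0 1)
      (f := fun x => (∑ i, c i * x ^ (i : ℕ)) ^ 2) (ae_of_all _ fun x => sq_nonneg _)
      (integrable_sq_sum_mul_pow integrable_pow_gaussianReal c) (η ^ 2)
    have hsub : Set.Icc (2 * j / (2 * k + 1) : ℝ) ((2 * j + 1) / (2 * k + 1)) ⊆
        {x : ℝ | η ^ 2 ≤ (∑ i, c i * x ^ (i : ℕ)) ^ 2} := hall
    have hw : ((2 * j + 1) / (2 * k + 1) - 2 * j / (2 * k + 1) : ℝ) / 6 =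
        (6 * (2 * k + 1) : ℝ)⁻¹ := by
      field_simp; ring
    rw [hw] at hmass
    have := mul_le_mul_of_nonneg_left (hmass.trans (measureReal_mono hsub)) (sq_nonneg η)
    linarith
  choose v hvmem hvlt using hpt
  have hk : (0 : ℝ) < 2 * k + 1 := by positivity
  have hcoef := abs_coeff_le_of_abs_eval_le c v (B := 2 * k + 1) hη0.le (fun j => ?_)
    (fun i j hij => ?_) (fun j => (abs_lt_of_sq_lt_sq (hvlt j) hη0.le).le)
  · have := Finset.sum_le_sum fun i (_ : i ∈ Finset.univ) => hcoef i
    rw [hc, Finset.sum_const, Finset.card_fin, nsmul_eq_mul] at this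
    have e : ((k + 1 : ℕ) : ℝ) * ((k + 1) * (η * (2 * (2 * k + 1)) ^ k)) = 1 / 2 := by
      rw [hη]; push_cast; field_simp
    linarith
  · have hj : (j : ℝ) ≤ k := by exact_mod_cast Nat.lt_succ_iff.1 j.2
    obtain ⟨h1, h2⟩ := hvmem j
    rw [abs_le]
    have h3 : (2 * j + 1 : ℝ) / (2 * k + 1) ≤ 1 := by
      rw [div_le_one hk]; linarith
    have h4 : (0 : ℝ) ≤ 2 * j / (2 * k + 1) := by positivity
    constructor <;> linarith
  · have key (i j : Fin (k + 1)) (h : i < j) : 1 ≤ (2 * k + 1) * (v j - v i) := by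
      have h1 := (hvmem j).1
      have h2 := (hvmem i).2
      rw [div_le_iff₀ hk] at h1
      rw [le_div_iff₀ hk] at h2
      have h3 : (i : ℝ) + 1 ≤ j := by exact_mod_cast h
      linarith
    rcases lt_or_gt_of_ne hij with h | h
    · exact (key i j h).trans (mul_le_mul_of_nonneg_left
        ((le_abs_self _).trans_eq (abs_sub_comm _ _)) hk.le)
    · exact (key j i h).trans (mul_le_mul_of_nonneg_left (le_abs_self _) hk.le)


lemma two_mul_sq_mul_le_pow {k : ℕ} (hk : 10 ^ 7 ≤ k) :
    2 * ((2 * (k + 1) ^ 2 * (2 * (2 * k + 1)) ^ k) ^ 2 * (6 * (2 * k + 1))) ≤ k ^ (3 * k) := by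
  have hk0 : k ≠ 0 := by omega
  calc 2 * ((2 * (k + 1) ^ 2 * (2 * (2 * k + 1)) ^ k) ^ 2 * (6 * (2 * k + 1)))
      ≤ 2 * ((2 * (2 * k) ^ 2 * (2 * (3 * k)) ^ k) ^ 2 * (6 * (3 * k))) := by
        gcongr <;> omega
    _ = 2304 * k ^ 5 * (36 ^ k * k ^ (2 * k)) := by
        rw [show 2 * (3 * k) = 6 * k by ring, mul_pow 6 k k, pow_mul,
          show 36 = 6 ^ 2 by norm_num, ← pow_mul, mul_comm 2 k, pow_mul, ← pow_mul k 2 k,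
          mul_comm 2 k, pow_mul k k 2]
        ring
    _ ≤ 2304 ^ k * (2 ^ k) ^ 5 * (36 ^ k * k ^ (2 * k)) := by
        gcongr
        · exact Nat.le_self_pow hk0 _
        · exact Nat.lt_two_pow_self.le
    _ = 2654208 ^ k * k ^ (2 * k) := by
        rw [← pow_mul, mul_comm k 5, pow_mul, ← mul_pow, ← mul_assoc, ← mul_pow]
        norm_num only
    _ ≤ k ^ k * k ^ (2 * k) := by gcongr; omega
    _ = k ^ (3 * k) := by rw [← pow_add]; congr 1; ring

lemma fifty_mul_pow_mul_pow_le_pow {k : ℕ} (hk : 10 ^ 7 ≤ k) :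
    50 * (3 * k) ^ (3 * k) * k ^ (6 * k) ≤ k ^ (10 * k) := by
  have hk0 : k ≠ 0 := by omega
  calc 50 * (3 * k) ^ (3 * k) * k ^ (6 * k) ≤ 50 ^ k * (3 * k) ^ (3 * k) * k ^ (6 * k) := by
        gcongr
        exact Nat.le_self_pow hk0 _
    _ = 1350 ^ k * k ^ (3 * k) * k ^ (6 * k) := by
        rw [mul_pow, pow_mul 3 3 k, ← mul_assoc, ← mul_pow]
        norm_num only
    _ ≤ k ^ k * k ^ (3 * k) * k ^ (6 * k) := by gcongr; omega
    _ = k ^ (10 * k) := by rw [← pow_add, ← pow_add]; congr 1; ring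

/-- If the moments of `μ` are close to Gaussian, a normalized polynomial that is nonnegative
`μ`-almost everywhere has mean much larger than the error in the moments. -/
lemma ten_mul_inv_le_integral {k : ℕ} (hk : 10 ^ 7 ≤ k) {μ : Measure ℝ}
    (hμ : ∀ n : ℕ, Integrable (fun x : ℝ => x ^ n) μ)
    (hclose : ∀ i : ℕ, i ≤ 10 * k →
      |(∫ x, x ^ i ∂μ) - ∫ x, x ^ i ∂(gaussianReal 0 1)| ≤ ((k : ℝ) ^ (10 * k))⁻¹)
    (c : Fin (k + 1) → ℝ) (hc : ∑ i, |c i| = 1)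
    (hp : ∀ᵐ x ∂μ, 0 ≤ ∑ i, c i * x ^ (i : ℕ)) :
    10 * ((k : ℝ) ^ (10 * k))⁻¹ ≤ ∫ x, ∑ i, c i * x ^ (i : ℕ) ∂μ := by
  have hk1 : (1 : ℝ) ≤ k := by exact_mod_cast (by omega : 1 ≤ k)
  have hk0 : (0 : ℝ) < k := by linarith
  have hsecond : ((k : ℝ) ^ (3 * k))⁻¹ ≤ ∫ x, (∑ i, c i * x ^ (i : ℕ)) ^ 2 ∂μ := by
    have h1 := le_integral_sq_gaussianReal c hc
    have h2 := abs_integral_sq_sub_integral_sq_le hμ integrable_pow_gaussianReal c hc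
      (fun n hn => hclose n (by omega))
    have h3 : ((k : ℝ) ^ (10 * k))⁻¹ ≤ ((k : ℝ) ^ (3 * k))⁻¹ := by
      exact inv_anti₀ (by positivity) (pow_le_pow_right₀ hk1 (by omega))
    have h4 : 2 * ((k : ℝ) ^ (3 * k))⁻¹ ≤
        (2 * (k + 1) ^ 2 * (2 * (2 * k + 1)) ^ k : ℝ)⁻¹ ^ 2 * (6 * (2 * k + 1) : ℝ)⁻¹ := by
      rw [inv_pow, ← mul_inv, ← div_eq_mul_inv, div_le_iff₀ (by positivity),
        inv_mul_eq_div, le_div_iff₀ (by positivity)]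
      exact_mod_cast two_mul_sq_mul_le_pow hk
    have := (abs_le.1 h2).1
    linarith
  have hthird : ∫ x, (∑ i, c i * x ^ (i : ℕ)) ^ 3 ∂μ ≤ 5 * ((3 * k : ℕ) : ℝ) ^ (3 * k) := by
    refine (le_abs_self _).trans (abs_integral_cube_sum_mul_pow_le hμ c hc fun n hn => ?_)
    have h1 := hclose n (by omega)
    have h2 := abs_integral_pow_gaussianReal_le n
    have h3 : (n.factorial : ℝ) ≤ ((3 * k : ℕ) : ℝ) ^ (3 * k) := by
      exact_mod_cast (Nat.factorial_le hn).trans (Nat.factorial_le_pow _)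
    have h4 : ((k : ℝ) ^ (10 * k))⁻¹ ≤ 1 := inv_le_one_of_one_le₀ (one_le_pow₀ hk1)
    have h5 : (1 : ℝ) ≤ ((3 * k : ℕ) : ℝ) ^ (3 * k) :=
      one_le_pow₀ (by exact_mod_cast (by omega : 1 ≤ 3 * k))
    have h6 := abs_sub_abs_le_abs_sub (∫ x, x ^ n ∂μ) (∫ x, x ^ n ∂(gaussianReal 0 1))
    linarith
  refine le_trans ?_ (sq_div_le_integral_of_nonneg hp (integrable_sum_mul_pow hμ c)
    (integrable_sq_sum_mul_pow hμ c) (integrable_cube_sum_mul_pow hμ c)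
    (by positivity) (by positivity) hsecond hthird)
  rw [le_div_iff₀ (by positivity), mul_comm 10, mul_assoc, inv_mul_le_iff₀ (by positivity), inv_pow,
    ← div_eq_mul_inv, le_div_iff₀ (by positivity), ← pow_mul,
    show 3 * k * 2 = 6 * k by ring, ← mul_assoc 10 5]
  norm_num only
  exact_mod_cast fifty_mul_pow_mul_pow_le_pow hk

/-- Homogeneous form of `ten_mul_inv_le_integral`. -/
lemma ten_mul_inv_mul_sum_abs_le_integral {k : ℕ} (hk : 10 ^ 7 ≤ k) {μ : Measure ℝ}
    (hμ : ∀ n : ℕ, Integrable (fun x : ℝ => x ^ n) μ)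
    (hclose : ∀ i : ℕ, i ≤ 10 * k →
      |(∫ x, x ^ i ∂μ) - ∫ x, x ^ i ∂(gaussianReal 0 1)| ≤ ((k : ℝ) ^ (10 * k))⁻¹)
    (c : Fin (k + 1) → ℝ) (hp : ∀ᵐ x ∂μ, 0 ≤ ∑ i, c i * x ^ (i : ℕ)) :
    10 * ((k : ℝ) ^ (10 * k))⁻¹ * ∑ i, |c i| ≤ ∫ x, ∑ i, c i * x ^ (i : ℕ) ∂μ := by
  have hA0 : 0 ≤ ∑ i, |c i| := Finset.sum_nonneg fun i _ => abs_nonneg _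
  rcases hA0.eq_or_lt with hA | hA
  · rw [← hA, mul_zero]
    exact integral_nonneg_of_ae hp
  · set A := ∑ i, |c i| with hAdef
    have hpt (x : ℝ) : ∑ i, c i / A * x ^ (i : ℕ) = (∑ i, c i * x ^ (i : ℕ)) / A := by
      rw [Finset.sum_div]
      exact Finset.sum_congr rfl fun i _ => by ring
    have h := ten_mul_inv_le_integral hk hμ hclose (fun i => c i / A)
      (by simp_rw [abs_div, abs_of_pos hA]; rw [← Finset.sum_div, div_self hA.ne'])
      (by filter_upwards [hp] with x hx; rw [hpt]; positivity)
    simp_rw [hpt] at h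
    rwa [integral_div, le_div_iff₀ hA] at h

/-- The moment vector `γ + 9 (γ - d)`, with `γ` the Gaussian moments and `d` those of a finitely
supported `μ` with nearly Gaussian moments, is realized by weights on the support of `μ`. -/
lemma exists_stdSimplex_moment_eq {k : ℕ} (hk : 10 ^ 7 ≤ k) {μ : Measure ℝ}
    [IsProbabilityMeasure μ] (T : Finset ℝ) (hT : μ (↑T)ᶜ = 0)
    (hμ : ∀ n : ℕ, Integrable (fun x : ℝ => x ^ n) μ)
    (hclose : ∀ i : ℕ, i ≤ 10 * k →
      |(∫ x, x ^ i ∂μ) - ∫ x, x ^ i ∂(gaussianReal 0 1)| ≤ ((k : ℝ) ^ (10 * k))⁻¹) :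
    ∃ q : T → ℝ, (∀ x, 0 ≤ q x) ∧ ∑ x, q x = 1 ∧ ∀ i ≤ k, ∑ x : T, q x * (x : ℝ) ^ i =
      (∫ x, x ^ i ∂μ) +
        10 * ((∫ x, x ^ i ∂(gaussianReal 0 1)) - ∫ x, x ^ i ∂μ) := by
  set m : Fin (k + 1) → ℝ := fun i => (∫ x, x ^ (i : ℕ) ∂μ) +
    10 * ((∫ x, x ^ (i : ℕ) ∂(gaussianReal 0 1)) - ∫ x, x ^ (i : ℕ) ∂μ) with hm
  let L : (T → ℝ) →ₗ[ℝ] (Fin (k + 1) → ℝ) :=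
    { toFun := fun q i => ∑ x : T, q x * (x : ℝ) ^ (i : ℕ)
      map_add' := fun q r => by ext i; simp [add_mul, Finset.sum_add_distrib]
      map_smul' := fun a q => by ext i; simp [mul_assoc, Finset.mul_sum] }
  suffices h : m ∈ L '' stdSimplex ℝ T by
    obtain ⟨q, hq, hqm⟩ := h
    exact ⟨q, hq.1, hq.2, fun i hi => congrFun hqm ⟨i, by omega⟩⟩
  by_contra hnot
  obtain ⟨f, u, hfm, hfu⟩ := geometric_hahn_banach_point_closed
    ((convex_stdSimplex ℝ T).linear_image L)
    ((isCompact_stdSimplex ℝ T).image (by fun_prop : Continuous L)).isClosed hnot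
  set b : Fin (k + 1) → ℝ := fun i => f (Pi.single i 1) with hb
  have hf (v : Fin (k + 1) → ℝ) : f v = ∑ i, b i * v i := by
    have := LinearMap.pi_apply_eq_sum_univ (f : (Fin (k + 1) → ℝ) →ₗ[ℝ] ℝ) v
    simp only [ContinuousLinearMap.coe_coe] at this
    rw [this]
    refine Finset.sum_congr rfl fun i _ => ?_
    rw [smul_eq_mul, mul_comm, hb]
    congr 2
    ext j
    simp [Pi.single_apply, eq_comm]
  set c : Fin (k + 1) → ℝ := b - Pi.single 0 u with hcdef
  have hcsum (v : Fin (k + 1) → ℝ) : ∑ i, c i * v i = f v - u * v 0 := by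
    simp [hcdef, hf, sub_mul, Finset.sum_sub_distrib, Pi.single_apply]
  have hpos : ∀ᵐ x ∂μ, 0 ≤ ∑ i, c i * x ^ (i : ℕ) := by
    have hTae : ∀ᵐ x ∂μ, x ∈ T := hT
    filter_upwards [hTae] with x hx
    rw [hcsum fun i : Fin (k + 1) => x ^ (i : ℕ)]
    have hx' := hfu _ ⟨Pi.single ⟨x, hx⟩ 1, single_mem_stdSimplex ℝ _, rfl⟩
    have hL : L (Pi.single ⟨x, hx⟩ 1) = fun i : Fin (k + 1) => x ^ (i : ℕ) := by
      ext i
      simp [L, Pi.single_apply]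
    rw [hL] at hx'
    simp only [Fin.val_zero, pow_zero]
    linarith
  have hmean := ten_mul_inv_mul_sum_abs_le_integral hk hμ hclose c hpos
  rw [integral_sum_mul_pow hμ] at hmean
  have hneg : ∑ i, c i * m i < 0 := by
    rw [hcsum]
    have : m 0 = 1 := by simp [hm]
    rw [this]
    linarith
  have herr : |∑ i, c i * ((∫ x, x ^ (i : ℕ) ∂μ) - ∫ x, x ^ (i : ℕ) ∂(gaussianReal 0 1))| ≤
      ((k : ℝ) ^ (10 * k))⁻¹ * ∑ i, |c i| := by
    rw [Finset.mul_sum]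
    refine (Finset.abs_sum_le_sum_abs _ _).trans (Finset.sum_le_sum fun i _ => ?_)
    rw [abs_mul, mul_comm]
    exact mul_le_mul_of_nonneg_right (hclose i (by omega)) (abs_nonneg _)
  have hsplit : ∑ i, c i * m i = ∑ i, c i * ∫ x, x ^ (i : ℕ) ∂μ -
      10 * ∑ i, c i * ((∫ x, x ^ (i : ℕ) ∂μ) - ∫ x, x ^ (i : ℕ) ∂(gaussianReal 0 1)) := by
    rw [Finset.mul_sum, ← Finset.sum_sub_distrib]
    exact Finset.sum_congr rfl fun i _ => by rw [hm]; ring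
  have := (abs_le.1 herr).2
  linarith

lemma eq_sum_smul_dirac_of_compl_eq_zero {μ : Measure ℝ} (T : Finset ℝ) (hT : μ (↑T)ᶜ = 0) :
    μ = ∑ x ∈ T, μ {x} • Measure.dirac x := by
  classical
  ext A hA
  rw [← measure_inter_add_sdiff A T.measurableSet,
    measure_mono_null (fun x hx => hx.2 : A \ T ⊆ (↑T)ᶜ) hT, add_zero,
    show A ∩ ↑T = ↑(T.filter (· ∈ A)) by ext; simp [and_comm], ← sum_measure_singleton,
    Finset.sum_filter]
  simp [Measure.finsetSum_apply, hA, Set.indicator_apply]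

/-- From approximate to exact moment matching: for all sufficiently large `k`,
any finitely supported distribution `D₀` whose moments up to degree `10k` are within `k^{−10k}`
of the standard Gaussian moments can be modified into a distribution `D₁`, supported on the
support of `D₀`, whose moments up to degree `k` match the Gaussian exactly and which retains at
least a `0.9` fraction of each atom of `D₀`. -/
theorem approx_to_exact_moment_matching :
    ∃ k₁ : ℕ, 0 < k₁ ∧
      ∀ k : ℕ, k₁ ≤ k →
        ∀ (D₀ : Measure ℝ) (S : Finset ℝ), IsProbabilityMeasure D₀ → D₀ (↑S)ᶜ = 0 →
          (∀ i : ℕ, i ≤ 10 * k →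
            |(∫ x, x ^ i ∂D₀) - ∫ x, x ^ i ∂(gaussianReal 0 1)| ≤ ((k : ℝ) ^ (10 * k))⁻¹) →
          ∃ D₁ : Measure ℝ, IsProbabilityMeasure D₁ ∧ D₁ (↑S)ᶜ = 0 ∧
            (∀ x₀ : ℝ, D₀ {x₀} = 0 → D₁ {x₀} = 0) ∧
            (∀ i : ℕ, i ≤ k → (∫ x, x ^ i ∂D₁) = ∫ x, x ^ i ∂(gaussianReal 0 1)) ∧
            ∀ x₀ : ℝ, D₀ {x₀} ≠ 0 →
              0.9 * (D₀ {x₀}).toReal ≤ (D₁ {x₀}).toReal := by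
  refine ⟨10 ^ 7, by norm_num, fun k hk D₀ S hD₀ hS hclose => ?_⟩
  classical
  set T : Finset ℝ := S.filter fun x => D₀ {x} ≠ 0 with hTdef
  have hT : D₀ (↑T)ᶜ = 0 := by
    have hcompl : (↑T : Set ℝ)ᶜ ⊆ (↑S)ᶜ ∪ ↑(S.filter fun x => D₀ {x} = 0) := by
      intro x hx
      by_cases hxS : x ∈ S <;> simp_all
    refine measure_mono_null hcompl (measure_union_null hS ?_)
    rw [← sum_measure_singleton]
    exact Finset.sum_eq_zero fun x hx => (Finset.mem_filter.1 hx).2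
  have hsum := eq_sum_smul_dirac_of_compl_eq_zero T hT
  have hint (n : ℕ) : Integrable (fun x : ℝ => x ^ n) D₀ := by
    rw [hsum]
    exact integrable_finsetSum_measure.2 fun x _ =>
      (integrable_dirac (by simp)).smul_measure (measure_ne_top _ _)
  obtain ⟨q, hq0, hq1, hqm⟩ := exists_stdSimplex_moment_eq hk T hT hint hclose
  let ν : Measure ℝ := ∑ x : T, ENNReal.ofReal (q x) • Measure.dirac (x : ℝ)
  have hν : IsProbabilityMeasure ν := ⟨by
    simp only [ν, Measure.finsetSum_apply, Measure.smul_apply, measure_univ, smul_eq_mul, mul_one]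
    rw [← ENNReal.ofReal_sum_of_nonneg (fun x _ => hq0 x), hq1, ENNReal.ofReal_one]⟩
  have hνT : ν (↑T)ᶜ = 0 := by
    simp [ν, Measure.finsetSum_apply]
  have hνint (n : ℕ) : Integrable (fun x : ℝ => x ^ n) ν :=
    integrable_finsetSum_measure.2 fun x _ =>
      (integrable_dirac (by simp)).smul_measure ENNReal.ofReal_ne_top
  have hνm (n : ℕ) : ∫ x, x ^ n ∂ν = ∑ x : T, q x * (x : ℝ) ^ n := by
    rw [integral_finsetSum_measure fun x _ =>
      (integrable_dirac (by simp)).smul_measure ENNReal.ofReal_ne_top]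
    simp [integral_smul_measure, ENNReal.toReal_ofReal (hq0 _)]
  refine ⟨ENNReal.ofReal 0.9 • D₀ + ENNReal.ofReal 0.1 • ν, ⟨?_⟩, ?_, fun x hx => ?_,
    fun i hi => ?_, fun x _ => ?_⟩
  · simp only [Measure.add_apply, Measure.smul_apply, measure_univ, smul_eq_mul, mul_one]
    rw [← ENNReal.ofReal_add (by norm_num) (by norm_num)]
    norm_num
  · have : ν (↑S)ᶜ = 0 :=
      measure_mono_null (Set.compl_subset_compl.2 (Finset.coe_subset.2 (S.filter_subset _))) hνT
    simp [hS, this]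
  · have hxT : ({x} : Set ℝ) ⊆ (↑T)ᶜ := by simp [hTdef, hx]
    simp [hx, measure_mono_null hxT hνT]
  · rw [integral_add_measure ((hint i).smul_measure ENNReal.ofReal_ne_top)
      ((hνint i).smul_measure ENNReal.ofReal_ne_top), integral_smul_measure, integral_smul_measure,
      hνm, hqm i hi, ENNReal.toReal_ofReal (by norm_num), ENNReal.toReal_ofReal (by norm_num),
      smul_eq_mul, smul_eq_mul]
    ring
  · have h : ENNReal.ofReal 0.9 * D₀ {x} ≤
        (ENNReal.ofReal 0.9 • D₀ + ENNReal.ofReal 0.1 • ν) {x} := by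
      simp
    have hfin : (ENNReal.ofReal 0.9 • D₀ + ENNReal.ofReal 0.1 • ν) {x} ≠ ⊤ := by
      simp [ENNReal.mul_eq_top]
    have := ENNReal.toReal_mono hfin h
    rwa [ENNReal.toReal_mul, ENNReal.toReal_ofReal (by norm_num)] at this
end
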